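/- Let h1 > h2 > 0 be fixed. For each λ ∈ (0,1) and h > 0, let 𝓛_h^λ be the probability distribution on ℕ × ℕ of the pair (N1, N2) obtained as follows: sample M ∈ ℕ with P(M = m) = (1 − λ)λ^m; given M, let N1 and N2 be conditionally independent, each distributed as G + S_M(λ,h), where G has law q_{λ,h} and is independent of S_M(λ,h). Then liminf_{λ ↗ 1} Σ_{y ∈ ℕ²} min(𝓛_{h1}^λ(y), 𝓛_{h2}^λ(y)) > 0. -/

import Mathlib

open Set Filter MeasureTheory

/-- Extinction-type parameter of the TKF91 model (deletion rate 1, insertion rate `lam`). -/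
noncomputable def eta (lam t : ℝ) : ℝ :=
  (1 - Real.exp (-(1 - lam) * t)) / (1 - lam * Real.exp (-(1 - lam) * t))

/-- TKF91 mortal-link progeny-length pmf `p_{λ,t}`. -/
noncomputable def pTKF (lam t : ℝ) : ℕ → ℝ
  | 0 => eta lam t
  | (n + 1) => (1 - eta lam t) * (1 - lam * eta lam t) * (lam * eta lam t) ^ n

/-- TKF91 immortal-link progeny pmf `q_{λ,t}`. -/
noncomputable def qTKF (lam t : ℝ) (n : ℕ) : ℝ :=
  (1 - lam * eta lam t) * (lam * eta lam t) ^ n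

/-- pmf of `S_M(λ,t)`, a sum of `M` i.i.d. variables with law `p_{λ,t}`
(`M`-fold convolution of `pTKF lam t`). -/
noncomputable def pS (lam t : ℝ) : ℕ → ℕ → ℝ
  | 0 => fun n => if n = 0 then 1 else 0
  | (M + 1) => fun n => ∑ k ∈ Finset.range (n + 1), pS lam t M k * pTKF lam t (n - k)

/-- pmf of the leaf sequence length `N = G + S_M(λ,t)` with `G ~ q_{λ,t}` independent. -/
noncomputable def pLeaf (lam t : ℝ) (M n : ℕ) : ℝ :=
  ∑ k ∈ Finset.range (n + 1), qTKF lam t k * pS lam t M (n - k)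

/-- Joint distribution on `ℕ × ℕ` of the pair of leaf lengths of the two-leaf star tree
of height `h`, with stationary geometric root length. -/
noncomputable def Ldist (lam h : ℝ) (y : ℕ × ℕ) : ℝ :=
  ∑' M : ℕ, (1 - lam) * lam ^ M * (pLeaf lam h M y.1 * pLeaf lam h M y.2)

/-- Mean of `p_{λ,t}`. -/
noncomputable def betaTKF (lam t : ℝ) : ℝ := Real.exp (-(1 - lam) * t)

/-- Standard deviation of `p_{λ,t}`. -/
noncomputable def sdev (lam t : ℝ) : ℝ :=
  Real.sqrt (∑' n : ℕ, ((n : ℝ) - betaTKF lam t) ^ 2 * pTKF lam t n)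

/-- `P(S_M(λ,t) ∈ (a,b))`. -/
noncomputable def probIn (lam t : ℝ) (M : ℕ) (a b : ℝ) : ℝ :=
  ∑' j : ℕ, if (j : ℝ) ∈ Set.Ioo a b then pS lam t M j else 0

/-- CDF of `S_M(λ,t)`. -/
noncomputable def cdfS (lam t : ℝ) (M : ℕ) (x : ℝ) : ℝ :=
  ∑' j : ℕ, if (j : ℝ) ≤ x then pS lam t M j else 0

/-- Standard normal CDF. -/
noncomputable def stdNormalCDF (x : ℝ) : ℝ :=
  ∫ u in Set.Iic x, Real.exp (-u ^ 2 / 2) / Real.sqrt (2 * Real.pi)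


/-- binomial pmf -/
noncomputable def bb (m : ℕ) (p : ℝ) (k : ℕ) : ℝ := (m.choose k : ℝ) * p ^ k * (1 - p) ^ (m - k)

lemma bb_nonneg (m : ℕ) {p : ℝ} (h0 : 0 ≤ p) (h1 : p ≤ 1) (k : ℕ) : 0 ≤ bb m p k := by
  unfold bb
  have : 0 ≤ 1 - p := by linarith
  positivity

lemma bb_succ (m : ℕ) (p : ℝ) (k : ℕ) :
    ((k : ℝ) + 1) * (1 - p) * bb m p (k + 1) = ((m : ℝ) - k) * p * bb m p k := by
  unfold bb
  rcases lt_trichotomy k m with h | h | h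
  · have e := Nat.choose_succ_right_eq m k
    have e' : (m.choose (k+1) : ℝ) * ((k : ℝ) + 1) = m.choose k * ((m : ℝ) - k) := by
      have := congrArg (Nat.cast (R := ℝ)) e
      push_cast [Nat.cast_sub h.le] at this
      exact this
    obtain ⟨d, rfl⟩ : ∃ d, m = k + 1 + d := ⟨m - (k+1), by omega⟩
    have h1 : k + 1 + d - (k + 1) = d := by omega
    have h2 : k + 1 + d - k = d + 1 := by omega
    rw [h1, h2, pow_succ, pow_succ]
    linear_combination (p ^ k * p * (1 - p) ^ d * (1 - p)) * e'
  · subst h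
    simp
  · rw [Nat.choose_eq_zero_of_lt h, Nat.choose_eq_zero_of_lt (by omega : m < k + 1)]
    simp

lemma bb_sum (m : ℕ) (p : ℝ) : ∑ k ∈ Finset.range (m + 1), bb m p k = 1 := by
  have := add_pow p (1 - p) m
  rw [show p + (1 - p) = 1 by ring, one_pow] at this
  rw [this]
  apply Finset.sum_congr rfl
  intro k _
  unfold bb
  ring

lemma bb_var (m : ℕ) (p : ℝ) :
    ∑ k ∈ Finset.range (m + 1), ((k : ℝ) - p * m) ^ 2 * bb m p k = m * p * (1 - p) := by
  have h := congrArg (Polynomial.eval p) (bernsteinPolynomial.variance ℝ m)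
  rw [Polynomial.eval_finsetSum] at h
  simp [bernsteinPolynomial] at h
  rw [← h]
  apply Finset.sum_congr rfl
  intro k _
  unfold bb
  ring

/-- one-step ratio bounds in the window -/
lemma bb_ratio {δ : ℝ} (hδ : 0 < δ) {m : ℕ} {p : ℝ} (hp : δ ≤ p) (hq : δ ≤ 1 - p)
    (hm : 8 / δ ≤ √m) (hm1 : 1 ≤ √m) {k : ℕ} (hk : |(k : ℝ) - p * m| ≤ 4 * √m) :
    bb m p k ≤ Real.exp (10 / δ ^ 2 / √m) * bb m p (k + 1) ∧
    bb m p (k + 1) ≤ Real.exp (10 / δ ^ 2 / √m) * bb m p k := by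
  have hs : √(m : ℝ) * √m = m := Real.mul_self_sqrt (by positivity)
  have hb0 := bb_nonneg m (by linarith : 0 ≤ p) (by linarith) k
  have hb1 := bb_nonneg m (by linarith : 0 ≤ p) (by linarith) (k + 1)
  have hr := bb_succ m p k
  obtain ⟨l, u⟩ := abs_le.mp hk
  set s := √(m : ℝ) with hsd
  have hspos : 0 < s := by linarith
  rw [div_le_iff₀ hδ] at hm
  rw [← hs] at l u hr
  have hpq : δ * δ ≤ p * (1 - p) := mul_le_mul hp hq hδ.le (by linarith)
  set a := ((k : ℝ) + 1) * (1 - p) with ha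
  set c := (s * s - (k : ℝ)) * p with hc
  -- lower bounds
  have hps : 8 ≤ p * s := by nlinarith
  have hqs : 8 ≤ (1 - p) * s := by nlinarith
  have ha0 : s * s * (δ * δ) / 2 ≤ a := by
    have h1 : p * (s * s) / 2 ≤ (k : ℝ) + 1 := by nlinarith
    have h2 : p * (s * s) / 2 * (1 - p) ≤ a := mul_le_mul_of_nonneg_right h1 (by linarith)
    nlinarith [mul_nonneg hspos.le hspos.le]
  have hc0 : s * s * (δ * δ) / 2 ≤ c := by
    have h1 : (1 - p) * (s * s) / 2 ≤ s * s - (k : ℝ) := by nlinarith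
    have h2 : (1 - p) * (s * s) / 2 * p ≤ c := mul_le_mul_of_nonneg_right h1 (by linarith)
    nlinarith [mul_nonneg hspos.le hspos.le]
  have hE : 1 + 10 / δ ^ 2 / s ≤ Real.exp (10 / δ ^ 2 / s) := by
    linarith [Real.add_one_le_exp (10 / δ ^ 2 / s)]
  have hdd : (10 / δ ^ 2 / s) * (s * s * (δ * δ) / 2) = 5 * s := by
    field_simp
    ring
  have hD : 0 < 10 / δ ^ 2 / s := by positivity
  have hpos : 0 < s * s * (δ * δ) / 2 := by positivity
  have hac : a ≤ Real.exp (10 / δ ^ 2 / s) * c := by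
    have h1 : a - c ≤ 5 * s := by
      have : a - c = k - p * (s * s) + (1 - p) := by rw [ha, hc]; ring
      linarith
    have h2 := mul_le_mul_of_nonneg_left hc0 hD.le
    have h3 := mul_le_mul_of_nonneg_right hE (hpos.le.trans hc0)
    rw [add_mul, one_mul] at h3
    linarith
  have hca : c ≤ Real.exp (10 / δ ^ 2 / s) * a := by
    have h1 : c - a ≤ 5 * s := by
      have : a - c = k - p * (s * s) + (1 - p) := by rw [ha, hc]; ring
      linarith
    have h2 := mul_le_mul_of_nonneg_left ha0 hD.le
    have h3 := mul_le_mul_of_nonneg_right hE (hpos.le.trans ha0)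
    rw [add_mul, one_mul] at h3
    linarith
  constructor
  · have : c * bb m p k ≤ c * (Real.exp (10 / δ ^ 2 / s) * bb m p (k + 1)) := by
      rw [← hr]
      have h2 := mul_le_mul_of_nonneg_right hac hb1
      linarith
    exact le_of_mul_le_mul_left this (hpos.trans_le hc0)
  · have : a * bb m p (k+1) ≤ a * (Real.exp (10 / δ ^ 2 / s) * bb m p k) := by
      rw [hr]
      have h2 := mul_le_mul_of_nonneg_right hca hb0
      linarith
    exact le_of_mul_le_mul_left this (hpos.trans_le ha0)

lemma bb_chain {δ : ℝ} (hδ : 0 < δ) {m : ℕ} {p : ℝ} (hp : δ ≤ p) (hq : δ ≤ 1 - p)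
    (hm : 8 / δ ≤ √m) (hm1 : 1 ≤ √m) (k d : ℕ) (hk : |(k : ℝ) - p * m| ≤ 4 * √m)
    (hkd : |((k + d : ℕ) : ℝ) - p * m| ≤ 4 * √m) :
    bb m p k ≤ Real.exp (10 / δ ^ 2 / √m * d) * bb m p (k + d) ∧
    bb m p (k + d) ≤ Real.exp (10 / δ ^ 2 / √m * d) * bb m p k := by
  induction d with
  | zero => simp
  | succ d ih =>
    have hmid : |((k + d : ℕ) : ℝ) - p * m| ≤ 4 * √m := by
      rw [abs_le] at *
      push_cast at *
      have : (0 : ℝ) ≤ d := by positivity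
      constructor <;> linarith
    obtain ⟨i1, i2⟩ := ih hmid
    obtain ⟨r1, r2⟩ := bb_ratio hδ hp hq hm hm1 hmid
    have he : Real.exp (10 / δ ^ 2 / √m * (d + 1 : ℕ)) =
      Real.exp (10 / δ ^ 2 / √m * d) * Real.exp (10 / δ ^ 2 / √m) := by
      rw [← Real.exp_add]; congr 1; push_cast; ring
    rw [he, ← add_assoc]
    constructor
    · refine i1.trans ?_
      rw [mul_assoc]
      gcongr
    · refine r2.trans ?_
      rw [mul_comm (Real.exp (10 / δ ^ 2 / √m * d)), mul_assoc]
      gcongr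

lemma bb_window {δ : ℝ} (hδ : 0 < δ) {m : ℕ} {p : ℝ} (hp : δ ≤ p) (hq : δ ≤ 1 - p)
    (hm : 8 / δ ≤ √m) (hm1 : 1 ≤ √m) (k j : ℕ) (hk : |(k : ℝ) - p * m| ≤ 4 * √m)
    (hj : |(j : ℝ) - p * m| ≤ 4 * √m) :
    bb m p j ≤ Real.exp (80 / δ ^ 2) * bb m p k := by
  have hb0 := bb_nonneg m (by linarith : 0 ≤ p) (by linarith) k
  have key : ∀ d : ℕ, (d : ℝ) ≤ 8 * √m →
      Real.exp (10 / δ ^ 2 / √m * d) ≤ Real.exp (80 / δ ^ 2) := by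
    intro d hd
    rw [Real.exp_le_exp]
    calc 10 / δ ^ 2 / √m * d ≤ 10 / δ ^ 2 / √m * (8 * √m) := by gcongr
      _ = 80 / δ ^ 2 := by field_simp; norm_num
  rcases le_total k j with h | h
  · obtain ⟨d, rfl⟩ := Nat.exists_eq_add_of_le h
    refine (bb_chain hδ hp hq hm hm1 k d hk hj).2.trans ?_
    refine mul_le_mul_of_nonneg_right (key d ?_) hb0
    rw [abs_le] at *
    push_cast at *
    linarith
  · obtain ⟨d, rfl⟩ := Nat.exists_eq_add_of_le h
    refine (bb_chain hδ hp hq hm hm1 j d hj hk).1.trans ?_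
    refine mul_le_mul_of_nonneg_right (key d ?_) hb0
    rw [abs_le] at *
    push_cast at *
    linarith

lemma bb_lower {δ : ℝ} (hδ : 0 < δ) {m : ℕ} {p : ℝ} (hp : δ ≤ p) (hq : δ ≤ 1 - p)
    (hm : 8 / δ ≤ √m) (hm1 : 1 ≤ √m) (k : ℕ) (hk : |(k : ℝ) - p * m| ≤ 4 * √m) :
    Real.exp (-(80 / δ ^ 2)) / 18 / √m ≤ bb m p k := by
  have hb := fun k => bb_nonneg m (by linarith : 0 ≤ p) (by linarith) k
  have hs : √(m : ℝ) * √m = m := Real.mul_self_sqrt (by positivity)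
  set s := √(m : ℝ) with hsd
  have hmpos : (0 : ℝ) < m := by rw [← hs]; positivity
  set W := (Finset.range (m + 1)).filter (fun j : ℕ => |(j : ℝ) - p * m| ≤ 4 * s) with hW
  have hsum : (1 / 2 : ℝ) ≤ ∑ j ∈ W, bb m p j := by
    have h1 : ∑ j ∈ Finset.range (m + 1), bb m p j
        ≤ ∑ j ∈ W, bb m p j + ∑ j ∈ Finset.range (m + 1), ((j : ℝ) - p * m) ^ 2 * bb m p j / (16 * m) := by
      rw [hW, Finset.sum_filter, ← Finset.sum_add_distrib]
      apply Finset.sum_le_sum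
      intro j _
      split_ifs with hj
      · have := hb j
        have : 0 ≤ ((j : ℝ) - p * m) ^ 2 * bb m p j / (16 * m) := by positivity
        linarith
      · push Not at hj
        rw [zero_add, le_div_iff₀ (by positivity), mul_comm]
        apply mul_le_mul_of_nonneg_right _ (hb j)
        rw [← sq_abs]
        nlinarith [abs_nonneg ((j : ℝ) - p * m)]
    rw [bb_sum, ← Finset.sum_div, bb_var] at h1
    have : (m : ℝ) * p * (1 - p) / (16 * m) ≤ 1 / 2 := by
      rw [div_le_iff₀ (by positivity)]
      nlinarith [sq_nonneg (p - 1/2)]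
    linarith
  have hcard : (W.card : ℝ) ≤ 9 * s := by
    have hsub : W ⊆ Finset.Icc ⌈p * m - 4 * s⌉₊ ⌊p * m + 4 * s⌋₊ := by
      intro j hj
      rw [hW, Finset.mem_filter, abs_le] at hj
      rw [Finset.mem_Icc]
      refine ⟨Nat.ceil_le.mpr (by linarith), Nat.le_floor (by linarith)⟩
    have h1 := Finset.card_le_card hsub
    rw [Nat.card_Icc] at h1
    have h2 : (⌊p * m + 4 * s⌋₊ : ℝ) ≤ p * m + 4 * s := Nat.floor_le (by
      have : 0 ≤ p * m := mul_nonneg (by linarith) hmpos.le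
      linarith)
    have h3 := Nat.le_ceil (p * m - 4 * s)
    rcases le_total ⌈p * m - 4 * s⌉₊ (⌊p * m + 4 * s⌋₊ + 1) with h | h
    · have h4 : (W.card : ℝ) ≤ ((⌊p * m + 4 * s⌋₊ + 1 - ⌈p * m - 4 * s⌉₊ : ℕ) : ℝ) := by exact_mod_cast h1
      rw [Nat.cast_sub h] at h4
      push_cast at h4
      linarith
    · have : W.card = 0 := by omega
      rw [this]
      simp
      linarith
  have hle : ∑ j ∈ W, bb m p j ≤ W.card * (Real.exp (80 / δ ^ 2) * bb m p k) := by
    rw [← nsmul_eq_mul]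
    apply Finset.sum_le_card_nsmul
    intro j hj
    exact bb_window hδ hp hq hm hm1 k j hk (Finset.mem_filter.mp hj).2
  have h5 : (1/2 : ℝ) ≤ 9 * s * (Real.exp (80 / δ ^ 2) * bb m p k) := by
    refine hsum.trans (hle.trans ?_)
    exact mul_le_mul_of_nonneg_right hcard (mul_nonneg (Real.exp_pos _).le (hb k))
  rw [Real.exp_neg, div_le_iff₀ (by positivity), div_le_iff₀ (by positivity),
    inv_le_iff_one_le_mul₀ (Real.exp_pos _)]
  linarith

lemma bb_conv {δ : ℝ} (hδ : 0 < δ) : ∃ c > 0, ∃ N0 : ℕ, ∀ N : ℕ, N0 ≤ N → ∀ M n : ℕ,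
    N ≤ M → M ≤ 3 * N → N ≤ n → n ≤ 3 * N → |(M : ℝ) - n| ≤ √N →
    ∀ p p' : ℝ, δ ≤ p → δ ≤ 1 - p → δ ≤ p' → δ ≤ 1 - p' → |p - p'| ≤ 2 / N →
    c / √N ≤ ∑ k ∈ Finset.range (M + 1), bb M p k * bb n p' k := by
  set c0 := Real.exp (-(80 / δ ^ 2)) / 18 with hc0
  have hc0p : 0 < c0 := by positivity
  refine ⟨c0 ^ 2 / 6, by positivity, ⌈(8 / δ) ^ 2⌉₊ + 49, ?_⟩
  intro N hN M n hM hM3 hn hn3 hMn p p' hp hq hp' hq' hpp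
  have hNr : ((⌈(8 / δ) ^ 2⌉₊ + 49 : ℕ) : ℝ) ≤ N := by exact_mod_cast hN
  push_cast at hNr
  have hce := Nat.le_ceil ((8 / δ) ^ 2)
  have hc00 : (0 : ℝ) ≤ ⌈(8 / δ) ^ 2⌉₊ := by positivity
  have hs7 : 7 ≤ √(N : ℝ) := Real.le_sqrt_of_sq_le (by linarith)
  have hs8 : 8 / δ ≤ √(N : ℝ) := Real.le_sqrt_of_sq_le (by linarith)
  have hs : √(N : ℝ) * √N = N := Real.mul_self_sqrt (by positivity)
  have hNpos : (0 : ℝ) < N := by linarith [sq_nonneg (8 / δ)]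
  set s := √(N : ℝ) with hsd
  have hMr : (N : ℝ) ≤ M := by exact_mod_cast hM
  have hnr : (N : ℝ) ≤ n := by exact_mod_cast hn
  have hM3r : (M : ℝ) ≤ 3 * N := by exact_mod_cast hM3
  have hn3r : (n : ℝ) ≤ 3 * N := by exact_mod_cast hn3
  have hsM : s ≤ √(M : ℝ) := Real.sqrt_le_sqrt hMr
  have hsn : s ≤ √(n : ℝ) := Real.sqrt_le_sqrt hnr
  have hMup : √(M : ℝ) ≤ √3 * s := by
    rw [hsd, ← Real.sqrt_mul (by norm_num)]; exact Real.sqrt_le_sqrt hM3r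
  have hnup : √(n : ℝ) ≤ √3 * s := by
    rw [hsd, ← Real.sqrt_mul (by norm_num)]; exact Real.sqrt_le_sqrt hn3r
  have h3 : √(3 : ℝ) * √3 = 3 := Real.mul_self_sqrt (by norm_num)
  set K := ⌊p * M⌋₊ with hK
  have hK1 : (K : ℝ) ≤ p * M := Nat.floor_le (mul_nonneg (by linarith) (by positivity))
  have hK2 : p * M < K + 1 := Nat.lt_floor_add_one _
  have hr1 : (Nat.sqrt N : ℝ) ≤ s := Real.nat_sqrt_le_real_sqrt
  have hr2 : s ≤ Nat.sqrt N + 1 := Real.real_sqrt_le_nat_sqrt_succ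
  have hpM : |p * M - p' * n| ≤ s + 6 := by
    have e : p * M - p' * n = p * ((M : ℝ) - n) + (p - p') * n := by ring
    rw [e]
    refine (abs_add_le _ _).trans ?_
    rw [abs_mul, abs_mul, abs_of_nonneg (by linarith : 0 ≤ p), abs_of_nonneg (by linarith : (0 : ℝ) ≤ n)]
    have h1 : p * |(M : ℝ) - n| ≤ 1 * s := mul_le_mul (by linarith) hMn (abs_nonneg _) (by norm_num)
    have h2 : |p - p'| * n ≤ 2 / N * (3 * N) := mul_le_mul hpp hn3r (by positivity) (by positivity)
    have h3 : 2 / (N : ℝ) * (3 * N) = 6 := by field_simp; norm_num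
    linarith
  have key : ∀ i ∈ Finset.range (Nat.sqrt N), c0 / (√3 * s) ≤ bb M p (K + i) ∧
      c0 / (√3 * s) ≤ bb n p' (K + i) := by
    intro i hi
    have hi' : (i : ℝ) + 1 ≤ s := by
      have : i + 1 ≤ Nat.sqrt N := Finset.mem_range.mp hi
      have : ((i + 1 : ℕ) : ℝ) ≤ (Nat.sqrt N : ℝ) := by exact_mod_cast this
      push_cast at this
      linarith
    have hi0 : (0 : ℝ) ≤ i := by positivity
    rw [abs_le] at hpM
    constructor
    · refine le_trans ?_ (bb_lower hδ hp hq (hs8.trans hsM) (by linarith) (K + i) ?_)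
      · rw [← hc0]
        exact div_le_div_of_nonneg_left hc0p.le (by linarith) hMup
      · rw [abs_le]; push_cast; constructor <;> linarith
    · refine le_trans ?_ (bb_lower hδ hp' hq' (hs8.trans hsn) (by linarith) (K + i) ?_)
      · rw [← hc0]
        exact div_le_div_of_nonneg_left hc0p.le (by linarith) hnup
      · rw [abs_le]; push_cast; constructor <;> linarith
  have hd : 0 < c0 / (√3 * s) := by positivity
  have hsub : (Finset.range (Nat.sqrt N)).image (fun i => K + i) ⊆ Finset.range (M + 1) := by
    intro k hk
    obtain ⟨i, hi, rfl⟩ := Finset.mem_image.mp hk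
    by_contra hcon
    have h0 : bb M p (K + i) = 0 := by
      unfold bb
      rw [Nat.choose_eq_zero_of_lt (by simpa using hcon)]
      simp
    have := (key i hi).1
    linarith
  calc c0 ^ 2 / 6 / s ≤ (Nat.sqrt N : ℝ) * (c0 / (√3 * s) * (c0 / (√3 * s))) := by
        have e : c0 / (√3 * s) * (c0 / (√3 * s)) = c0 ^ 2 / 3 / s / s := by
          rw [div_mul_div_comm, show √3 * s * (√3 * s) = (√3 * √3) * (s * s) by ring, h3]
          field_simp
        have h : s / 2 ≤ Nat.sqrt N := by linarith
        rw [e]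
        calc c0 ^ 2 / 6 / s = s / 2 * (c0 ^ 2 / 3 / s / s) := by field_simp; norm_num
          _ ≤ _ := by gcongr
    _ ≤ ∑ i ∈ Finset.range (Nat.sqrt N), bb M p (K + i) * bb n p' (K + i) := by
        rw [← nsmul_eq_mul]
        have := Finset.card_nsmul_le_sum (Finset.range (Nat.sqrt N))
          (fun i => bb M p (K + i) * bb n p' (K + i)) (c0 / (√3 * s) * (c0 / (√3 * s))) (by
            intro i hi
            obtain ⟨k1, k2⟩ := key i hi
            exact mul_le_mul k1 k2 hd.le (hd.le.trans k1))
        simpa using this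
    _ = ∑ k ∈ (Finset.range (Nat.sqrt N)).image (fun i => K + i), bb M p k * bb n p' k := by
        rw [Finset.sum_image]
        intro a _ b _ h
        simpa using h
    _ ≤ _ := by
        apply Finset.sum_le_sum_of_subset_of_nonneg hsub
        intro k _ _
        exact mul_nonneg (bb_nonneg M (by linarith) (by linarith) k)
          (bb_nonneg n (by linarith) (by linarith) k)

open PowerSeries in
lemma mk_pS (lam t : ℝ) (M : ℕ) :
    (PowerSeries.mk (pS lam t M) : ℝ⟦X⟧) = (PowerSeries.mk (pTKF lam t)) ^ M := by
  induction M with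
  | zero =>
    ext n
    simp [pS, PowerSeries.coeff_one]
  | succ M ih =>
    rw [pow_succ, ← ih]
    ext n
    rw [PowerSeries.coeff_mul, Finset.Nat.sum_antidiagonal_eq_sum_range_succ_mk]
    simp [pS]

open PowerSeries in
lemma mk_pLeaf (lam t : ℝ) (M : ℕ) :
    (PowerSeries.mk (pLeaf lam t M) : ℝ⟦X⟧) =
      PowerSeries.mk (qTKF lam t) * (PowerSeries.mk (pTKF lam t)) ^ M := by
  rw [← mk_pS]
  ext n
  rw [PowerSeries.coeff_mul, Finset.Nat.sum_antidiagonal_eq_sum_range_succ_mk]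
  simp [pLeaf]

open PowerSeries in
/-- negative binomial generating series -/
noncomputable def gser (a : ℝ) (k : ℕ) : ℝ⟦X⟧ :=
  PowerSeries.mk fun n => (n.choose k : ℝ) * (1 - a) ^ (k + 1) * a ^ (n - k)

open PowerSeries in
lemma gser_succ (a : ℝ) (k : ℕ) :
    (1 - C a * X) * gser a (k + 1) = C (1 - a) * X * gser a k := by
  ext n
  rw [sub_mul, one_mul, mul_assoc, mul_assoc, map_sub, coeff_C_mul, coeff_C_mul]
  cases n with
  | zero => simp [gser]
  | succ n =>
    rw [coeff_succ_X_mul, coeff_succ_X_mul]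
    simp only [gser, coeff_mk, Nat.add_sub_add_right, Nat.choose_succ_succ, Nat.cast_add]
    rcases Nat.lt_or_ge n (k + 1) with h | h
    · rw [Nat.choose_eq_zero_of_lt h]
      simp
      ring
    · obtain ⟨d, rfl⟩ := Nat.exists_eq_add_of_le h
      rw [show k + 1 + d - k = d + 1 by omega, show k + 1 + d - (k + 1) = d by omega]
      ring

open PowerSeries in
lemma pser (lam t : ℝ) :
    (1 - C (lam * eta lam t) * X) * (PowerSeries.mk (pTKF lam t) - C (eta lam t)) =
      C ((1 - eta lam t) * (1 - lam * eta lam t)) * X := by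
  ext n
  rw [sub_mul, one_mul, mul_assoc, map_sub, coeff_C_mul, coeff_C_mul]
  cases n with
  | zero => simp [pTKF]
  | succ n =>
    rw [coeff_succ_X_mul]
    cases n with
    | zero => simp [pTKF]
    | succ n => 
      simp [pTKF, coeff_X]
      ring

open PowerSeries in
lemma gser_mul (lam t : ℝ) (k : ℕ) :
    gser (lam * eta lam t) k * (PowerSeries.mk (pTKF lam t) - C (eta lam t)) =
      C (1 - eta lam t) * gser (lam * eta lam t) (k + 1) := by
  have hne : (1 - C (lam * eta lam t) * X : ℝ⟦X⟧) ≠ 0 := by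
    intro h
    have := congrArg (coeff 0) h
    simp at this
  apply mul_left_cancel₀ hne
  have h1 := pser lam t
  have h2 := gser_succ (lam * eta lam t) k
  rw [map_mul C (1 - eta lam t)] at h1
  linear_combination gser (lam * eta lam t) k * h1 - C (1 - eta lam t) * h2

open PowerSeries in
lemma gser_pow (lam t : ℝ) (k : ℕ) :
    gser (lam * eta lam t) 0 * (PowerSeries.mk (pTKF lam t) - C (eta lam t)) ^ k =
      C ((1 - eta lam t) ^ k) * gser (lam * eta lam t) k := by
  induction k with
  | zero => simp
  | succ k ih =>
    rw [pow_succ, ← mul_assoc, ih, mul_assoc, gser_mul, ← mul_assoc, ← map_mul, pow_succ]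

open PowerSeries in
lemma pLeaf_eq (lam t : ℝ) (M n : ℕ) :
    pLeaf lam t M n = (1 - lam * eta lam t) * ∑ k ∈ Finset.range (M + 1),
      bb M (1 - eta lam t) k * bb n (1 - lam * eta lam t) k := by
  have hq : PowerSeries.mk (qTKF lam t) = gser (lam * eta lam t) 0 := by
    ext n
    simp [qTKF, gser]
  have h := congrArg (coeff n) (mk_pLeaf lam t M)
  rw [coeff_mk, hq, show PowerSeries.mk (pTKF lam t) =
    (PowerSeries.mk (pTKF lam t) - C (eta lam t)) + C (eta lam t) by ring, add_pow,
    Finset.mul_sum, map_sum] at h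
  rw [h, Finset.mul_sum]
  apply Finset.sum_congr rfl
  intro k _
  rw [← mul_assoc, ← mul_assoc, gser_pow, ← map_pow, ← map_natCast (C (R := ℝ)),
    show ∀ a b c : ℝ, ∀ f : ℝ⟦X⟧, C a * f * C b * C c = C (a * b * c) * f by
      intro a b c f; simp only [map_mul]; ring, coeff_C_mul]
  simp only [gser, coeff_mk, bb, sub_sub_cancel]
  ring

lemma eta_bounds {lam t : ℝ} (h0 : 0 < lam) (h1 : lam < 1) (ht : 0 < t) :
    t / (t + 1) ≤ eta lam t ∧ Real.exp (-t) / (t + 1) ≤ 1 - eta lam t := by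
  set x := 1 - lam with hx
  have hx0 : 0 < x := by linarith
  have hx1 : x < 1 := by linarith
  set E := Real.exp (-x * t) with hE
  have hEp : 0 < E := Real.exp_pos _
  have hu1 : x * t * E ≤ 1 - E := by
    have h := Real.add_one_le_exp (x * t)
    have h2 : Real.exp (x * t) * E = 1 := by rw [hE, ← Real.exp_add]; simp
    nlinarith
  have hu2 : 1 - E ≤ x * t := by
    have h := Real.add_one_le_exp (-x * t)
    rw [← hE] at h
    linarith
  have hEt : Real.exp (-t) ≤ E := by
    rw [hE, Real.exp_le_exp]; nlinarith
  have hE1 : E ≤ 1 := by nlinarith [mul_pos (mul_pos hx0 ht) hEp]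
  have hden : 1 - lam * E = (1 - E) + x * E := by rw [hx]; ring
  have hxt : 0 < x * t := by positivity
  have hpos : 0 < (1 - E) + x * E := by
    have : 0 < x * E := by positivity
    linarith
  have he : eta lam t = (1 - E) / ((1 - E) + x * E) := by
    unfold eta
    rw [← hx, ← hE, hden]
  have he' : 1 - eta lam t = (x * E) / ((1 - E) + x * E) := by
    rw [he, eq_div_iff hpos.ne', sub_mul, div_mul_cancel₀ _ hpos.ne']; ring
  rw [he', he]
  constructor
  · rw [div_le_div_iff₀ (by linarith) hpos]
    nlinarith
  · rw [div_le_div_iff₀ (by linarith) hpos]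
    have : (1 - E) + x * E ≤ x * (t + 1) := by nlinarith
    calc Real.exp (-t) * (1 - E + x * E) ≤ E * (x * (t + 1)) := by gcongr
      _ = _ := by ring

lemma eta_mem {lam t : ℝ} (h0 : 0 < lam) (h1 : lam < 1) (ht : 0 < t) :
    0 < eta lam t ∧ eta lam t < 1 := by
  obtain ⟨a, b⟩ := eta_bounds h0 h1 ht
  have : 0 < t / (t + 1) := by positivity
  have : 0 < Real.exp (-t) / (t + 1) := by positivity
  constructor <;> linarith

lemma geom_part {a : ℝ} (h0 : 0 ≤ a) (n : ℕ) :
    ∑ i ∈ Finset.range n, (1 - a) * a ^ i ≤ 1 := by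
  rw [← Finset.mul_sum, mul_neg_geom_sum]
  linarith [pow_nonneg h0 n]

lemma conv_part (f g : ℕ → ℝ) (hf : ∀ n, 0 ≤ f n) (hg : ∀ n, 0 ≤ g n)
    (hf1 : ∀ K, ∑ n ∈ Finset.range K, f n ≤ 1) (hg1 : ∀ K, ∑ n ∈ Finset.range K, g n ≤ 1) (K : ℕ) :
    ∑ n ∈ Finset.range K, ∑ k ∈ Finset.range (n + 1), f k * g (n - k) ≤ 1 := by
  have h1 : ∑ n ∈ Finset.range K, ∑ k ∈ Finset.range (n + 1), f k * g (n - k)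
      ≤ (∑ n ∈ Finset.range K, f n) * ∑ n ∈ Finset.range K, g n := by
    rw [Finset.sum_mul_sum, ← Finset.sum_product', Finset.sum_sigma']
    have hinj : ∀ a ∈ (Finset.range K).sigma (fun n => Finset.range (n + 1)),
      ∀ b ∈ (Finset.range K).sigma (fun n => Finset.range (n + 1)),
      ((a.2, a.1 - a.2) : ℕ × ℕ) = (b.2, b.1 - b.2) → a = b := by
      rintro ⟨a1, a2⟩ ha ⟨b1, b2⟩ hb h
      simp only [Finset.mem_sigma, Finset.mem_range, Prod.mk.injEq] at ha hb h
      obtain ⟨rfl, h⟩ := h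
      have : a1 = b1 := by omega
      subst this
      rfl
    rw [← Finset.sum_image (g := fun a : (_ : ℕ) × ℕ => ((a.2, a.1 - a.2) : ℕ × ℕ))
      (f := fun z : ℕ × ℕ => f z.1 * g z.2) hinj]
    apply Finset.sum_le_sum_of_subset_of_nonneg
    · intro z hz
      simp only [Finset.mem_image, Finset.mem_sigma, Finset.mem_range] at hz
      obtain ⟨a, ha, rfl⟩ := hz
      simp only [Finset.mem_product, Finset.mem_range]
      omega
    · intro z _ _
      exact mul_nonneg (hf _) (hg _)
  refine h1.trans ?_
  exact mul_le_one₀ (hf1 K) (Finset.sum_nonneg fun n _ => hg n) (hg1 K)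

section
variable {lam t : ℝ}

lemma al_mem (h0 : 0 < lam) (h1 : lam < 1) (ht : 0 < t) :
    0 ≤ lam * eta lam t ∧ lam * eta lam t ≤ 1 := by
  obtain ⟨a, b⟩ := eta_mem h0 h1 ht
  constructor
  · positivity
  · nlinarith

lemma pTKF_nonneg (h0 : 0 < lam) (h1 : lam < 1) (ht : 0 < t) (n : ℕ) : 0 ≤ pTKF lam t n := by
  obtain ⟨a, b⟩ := eta_mem h0 h1 ht
  obtain ⟨c, d⟩ := al_mem h0 h1 ht
  cases n with
  | zero => exact a.le
  | succ n => exact mul_nonneg (mul_nonneg (by linarith) (by linarith)) (pow_nonneg c n)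

lemma pTKF_part (h0 : 0 < lam) (h1 : lam < 1) (ht : 0 < t) (K : ℕ) :
    ∑ n ∈ Finset.range K, pTKF lam t n ≤ 1 := by
  obtain ⟨a, b⟩ := eta_mem h0 h1 ht
  obtain ⟨c, d⟩ := al_mem h0 h1 ht
  cases K with
  | zero => simp
  | succ K =>
    rw [Finset.sum_range_succ']
    simp only [pTKF, mul_assoc]
    rw [← Finset.mul_sum]
    have := geom_part c K
    nlinarith

lemma pS_prop (h0 : 0 < lam) (h1 : lam < 1) (ht : 0 < t) (M : ℕ) :
    (∀ n, 0 ≤ pS lam t M n) ∧ ∀ K, ∑ n ∈ Finset.range K, pS lam t M n ≤ 1 := by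
  induction M with
  | zero =>
    constructor
    · intro n
      simp only [pS]
      split_ifs <;> norm_num
    · intro K
      simp only [pS, Finset.sum_ite_eq']
      split_ifs <;> norm_num
  | succ M ih =>
    constructor
    · intro n
      exact Finset.sum_nonneg fun k _ => mul_nonneg (ih.1 k) (pTKF_nonneg h0 h1 ht _)
    · intro K
      exact conv_part _ _ ih.1 (pTKF_nonneg h0 h1 ht) ih.2 (pTKF_part h0 h1 ht) K

lemma qTKF_nonneg (h0 : 0 < lam) (h1 : lam < 1) (ht : 0 < t) (n : ℕ) : 0 ≤ qTKF lam t n := by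
  obtain ⟨c, d⟩ := al_mem h0 h1 ht
  exact mul_nonneg (by linarith) (pow_nonneg c n)

lemma pLeaf_nonneg (h0 : 0 < lam) (h1 : lam < 1) (ht : 0 < t) (M n : ℕ) : 0 ≤ pLeaf lam t M n :=
  Finset.sum_nonneg fun k _ => mul_nonneg (qTKF_nonneg h0 h1 ht k) ((pS_prop h0 h1 ht M).1 _)

lemma pLeaf_part (h0 : 0 < lam) (h1 : lam < 1) (ht : 0 < t) (M K : ℕ) :
    ∑ n ∈ Finset.range K, pLeaf lam t M n ≤ 1 := by
  have := pS_prop h0 h1 ht M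
  exact conv_part _ _ (qTKF_nonneg h0 h1 ht) this.1
    (geom_part (al_mem h0 h1 ht).1) this.2 K

lemma pLeaf_le_one (h0 : 0 < lam) (h1 : lam < 1) (ht : 0 < t) (M n : ℕ) : pLeaf lam t M n ≤ 1 :=
  (Finset.single_le_sum (f := pLeaf lam t M) (fun i _ => pLeaf_nonneg h0 h1 ht M i)
    (Finset.self_mem_range_succ n)).trans (pLeaf_part h0 h1 ht M (n + 1))

lemma geo_hasSum (h0 : 0 < lam) (h1 : lam < 1) : HasSum (fun M : ℕ => (1 - lam) * lam ^ M) 1 := by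
  have := (hasSum_geometric_of_lt_one h0.le h1).mul_left (1 - lam)
  rwa [mul_inv_cancel₀ (by linarith)] at this

lemma term_nonneg (h0 : 0 < lam) (h1 : lam < 1) (ht : 0 < t) (y : ℕ × ℕ) (M : ℕ) :
    0 ≤ (1 - lam) * lam ^ M * (pLeaf lam t M y.1 * pLeaf lam t M y.2) :=
  mul_nonneg (mul_nonneg (by linarith) (pow_nonneg h0.le M))
    (mul_nonneg (pLeaf_nonneg h0 h1 ht M _) (pLeaf_nonneg h0 h1 ht M _))

lemma term_summable (h0 : 0 < lam) (h1 : lam < 1) (ht : 0 < t) (y : ℕ × ℕ) :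
    Summable fun M : ℕ => (1 - lam) * lam ^ M * (pLeaf lam t M y.1 * pLeaf lam t M y.2) := by
  refine Summable.of_nonneg_of_le (term_nonneg h0 h1 ht y) (fun M => ?_) (geo_hasSum h0 h1).summable
  exact mul_le_of_le_one_right (mul_nonneg (by linarith) (pow_nonneg h0.le M))
    (mul_le_one₀ (pLeaf_le_one h0 h1 ht M _) (pLeaf_nonneg h0 h1 ht M _) (pLeaf_le_one h0 h1 ht M _))

lemma Ldist_nonneg (h0 : 0 < lam) (h1 : lam < 1) (ht : 0 < t) (y : ℕ × ℕ) : 0 ≤ Ldist lam t y :=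
  tsum_nonneg (term_nonneg h0 h1 ht y)

lemma Ldist_part (h0 : 0 < lam) (h1 : lam < 1) (ht : 0 < t) (s : Finset (ℕ × ℕ)) :
    ∑ y ∈ s, Ldist lam t y ≤ 1 := by
  unfold Ldist
  rw [← Summable.tsum_finsetSum (fun y _ => term_summable h0 h1 ht y)]
  refine le_trans ?_ (geo_hasSum h0 h1).tsum_eq.le
  refine Summable.tsum_le_tsum (fun M => ?_)
    (summable_sum fun y _ => term_summable h0 h1 ht y) (geo_hasSum h0 h1).summable
  rw [← Finset.mul_sum]
  refine mul_le_of_le_one_right (mul_nonneg (by linarith) (pow_nonneg h0.le M)) ?_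
  obtain ⟨K, hK⟩ : ∃ K, s ⊆ Finset.range K ×ˢ Finset.range K := by
    refine ⟨s.sup (fun y => y.1 + y.2) + 1, fun y hy => ?_⟩
    have := Finset.le_sup (f := fun y : ℕ × ℕ => y.1 + y.2) hy
    simp only [Finset.mem_product, Finset.mem_range]
    omega
  refine (Finset.sum_le_sum_of_subset_of_nonneg hK fun y _ _ =>
    mul_nonneg (pLeaf_nonneg h0 h1 ht M _) (pLeaf_nonneg h0 h1 ht M _)).trans ?_
  rw [Finset.sum_product, ← Finset.sum_mul_sum]
  exact mul_le_one₀ (pLeaf_part h0 h1 ht M K)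
    (Finset.sum_nonneg fun n _ => pLeaf_nonneg h0 h1 ht M n) (pLeaf_part h0 h1 ht M K)

end

lemma Ldist_lower {h : ℝ} (hh : 0 < h) : ∃ c > 0, ∃ N0 : ℕ, ∀ N : ℕ, N0 ≤ N → ∀ lam : ℝ,
    1 / 2 ≤ lam → lam < 1 → 1 ≤ N * (1 - lam) → N * (1 - lam) ≤ 2 →
    ∀ a i : ℕ, a < N → i < Nat.sqrt N → c / (N * √N) ≤ Ldist lam h (N + a, N + a + i) := by
  set δ := min (h / (h + 1) / 2) (Real.exp (-h) / (h + 1)) with hδd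
  have hδ : 0 < δ := by rw [hδd]; positivity
  have hδ1 : δ ≤ h / (h + 1) / 2 := min_le_left _ _
  have hδ2 : δ ≤ Real.exp (-h) / (h + 1) := min_le_right _ _
  obtain ⟨c, hc, N0, H⟩ := bb_conv hδ
  refine ⟨Real.exp (-12) * (δ * c) ^ 2 / 2, by positivity, N0 + 4, ?_⟩
  intro N hN lam hl hl1 hN1 hN2 a i ha hi
  have hN4 : (4 : ℝ) ≤ N := by exact_mod_cast (by omega : 4 ≤ N)
  have hsN : √(N : ℝ) * √N = N := Real.mul_self_sqrt (by positivity)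
  have hs2 : 2 ≤ √(N : ℝ) := Real.le_sqrt_of_sq_le (by linarith)
  have hr1 : (Nat.sqrt N : ℝ) ≤ √N := Real.nat_sqrt_le_real_sqrt
  have hr2 : √N ≤ (Nat.sqrt N : ℝ) + 1 := Real.real_sqrt_le_nat_sqrt_succ
  have hsq : Nat.sqrt N ≤ N := Nat.sqrt_le_self N
  set s := √(N : ℝ) with hs
  have h0 : 0 < lam := by linarith
  obtain ⟨e1, e2⟩ := eta_bounds h0 hl1 hh
  obtain ⟨e3, e4⟩ := eta_mem h0 hl1 hh
  have leaf : ∀ M n : ℕ, N ≤ M → M ≤ 3 * N → N ≤ n → n ≤ 3 * N → |(M : ℝ) - n| ≤ s →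
      δ * c / s ≤ pLeaf lam h M n := by
    intro M n q1 q2 q3 q4 q5
    rw [pLeaf_eq, mul_div_assoc]
    have hpos : 0 < h / (h + 1) := by positivity
    have := H N (by omega) M n q1 q2 q3 q4 q5 (1 - eta lam h) (1 - lam * eta lam h)
      (by linarith) (by linarith) (by nlinarith) (by nlinarith) (by
        rw [show 1 - eta lam h - (1 - lam * eta lam h) = - ((1 - lam) * eta lam h) by ring, abs_neg,
          abs_of_nonneg (mul_nonneg (by linarith) e3.le), le_div_iff₀ (by linarith)]
        nlinarith)
    refine mul_le_mul (by nlinarith) this (by positivity) (by nlinarith)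
  have hpow : ∀ M : ℕ, M ≤ 3 * N → Real.exp (-12) ≤ lam ^ M := by
    intro M hM
    have hMr : (M : ℝ) ≤ 3 * N := by exact_mod_cast hM
    have h1 : Real.exp (-(2 * (1 - lam))) ≤ lam := by
      rw [Real.exp_neg, inv_le_comm₀ (Real.exp_pos _) h0]
      have := Real.add_one_le_exp (2 * (1 - lam))
      refine le_trans ?_ this
      rw [inv_le_iff_one_le_mul₀ h0]
      nlinarith
    calc Real.exp (-12) ≤ Real.exp (-(2 * (1 - lam))) ^ M := by
          rw [← Real.exp_nat_mul, Real.exp_le_exp]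
          nlinarith
      _ ≤ _ := pow_le_pow_left₀ (Real.exp_pos _).le h1 M
  have hterm : ∀ j ∈ Finset.range (Nat.sqrt N), 1 / N * Real.exp (-12) * (δ * c / s * (δ * c / s)) ≤
      (1 - lam) * lam ^ (N + a + j) * (pLeaf lam h (N + a + j) (N + a) * pLeaf lam h (N + a + j) (N + a + i)) := by
    intro j hj
    have hj := Finset.mem_range.mp hj
    have hjr : (j : ℝ) ≤ Nat.sqrt N := by exact_mod_cast hj.le
    have hir : (i : ℝ) ≤ Nat.sqrt N := by exact_mod_cast hi.le
    have l1 := leaf (N + a + j) (N + a) (by omega) (by omega) (by omega) (by omega) (by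
      push_cast
      rw [abs_le]
      constructor <;> linarith [(Nat.cast_nonneg j : (0 : ℝ) ≤ j)])
    have l2 := leaf (N + a + j) (N + a + i) (by omega) (by omega) (by omega) (by omega) (by
      push_cast
      rw [abs_le]
      constructor <;> linarith [(Nat.cast_nonneg j : (0 : ℝ) ≤ j), (Nat.cast_nonneg i : (0 : ℝ) ≤ i)])
    have l3 := hpow (N + a + j) (by omega)
    have l4 : 1 / (N : ℝ) ≤ 1 - lam := by
      rw [div_le_iff₀ (by linarith)]
      linarith
    have hd0 : 0 < δ * c / s := by positivity
    have hl0 : 0 ≤ 1 - lam := by linarith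
    have hp0 := hd0.le.trans l1
    gcongr
  have hsum := (term_summable h0 hl1 hh (N + a, N + a + i)).sum_le_tsum
    ((Finset.range (Nat.sqrt N)).image (fun j => N + a + j))
    (fun M _ => term_nonneg h0 hl1 hh _ M)
  rw [Finset.sum_image (by intro x _ y _ hxy; simpa using hxy)] at hsum
  refine le_trans ?_ hsum
  refine le_trans ?_ (Finset.card_nsmul_le_sum _ _ _ hterm)
  rw [Finset.card_range, nsmul_eq_mul]
  calc Real.exp (-12) * (δ * c) ^ 2 / 2 / (N * s)
      = s / 2 * (1 / N * Real.exp (-12) * (δ * c * (δ * c) / (s * s))) := by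
        have : 0 < s := by linarith
        field_simp
    _ ≤ (Nat.sqrt N : ℝ) * (1 / N * Real.exp (-12) * (δ * c * (δ * c) / (s * s))) := by
        have : s / 2 ≤ Nat.sqrt N := by linarith
        gcongr
    _ = _ := by rw [div_mul_div_comm]

/-- The overlap `Σ_y min(𝓛_{h1}^λ(y), 𝓛_{h2}^λ(y))` has strictly positive `liminf`
as `λ ↗ 1`, for heights `h1 > h2 > 0`. -/
theorem overlap_liminf_pos (h1 h2 : ℝ) (hh : h1 > h2) (hh2 : h2 > 0) :
    0 < Filter.liminf
      (fun lam : ℝ => ∑' y : ℕ × ℕ, min (Ldist lam h1 y) (Ldist lam h2 y))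
      (nhdsWithin 1 (Set.Iio 1)) := by
  have hh1 : 0 < h1 := by linarith
  obtain ⟨c1, hc1, N1, H1⟩ := Ldist_lower hh1
  obtain ⟨c2, hc2, N2, H2⟩ := Ldist_lower hh2
  have hnear : ∀ ε : ℝ, 0 < ε → ∀ᶠ lam in nhdsWithin (1 : ℝ) (Set.Iio 1), 1 - ε < lam ∧ lam < 1 := by
    intro ε hε
    filter_upwards [Ioo_mem_nhdsLT (by linarith : 1 - ε < (1 : ℝ))] with lam hl using hl
  have hsummable : ∀ lam : ℝ, 0 < lam → lam < 1 →
      Summable (fun y : ℕ × ℕ => min (Ldist lam h1 y) (Ldist lam h2 y)) ∧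
      ∑' y : ℕ × ℕ, min (Ldist lam h1 y) (Ldist lam h2 y) ≤ 1 := by
    intro lam h0 hl
    have hn : ∀ y, 0 ≤ min (Ldist lam h1 y) (Ldist lam h2 y) := fun y =>
      le_min (Ldist_nonneg h0 hl hh1 y) (Ldist_nonneg h0 hl hh2 y)
    have hs : ∀ s : Finset (ℕ × ℕ), ∑ y ∈ s, min (Ldist lam h1 y) (Ldist lam h2 y) ≤ 1 := fun s =>
      (Finset.sum_le_sum fun y _ => min_le_left _ _).trans (Ldist_part h0 hl hh1 s)
    exact ⟨summable_of_sum_le hn hs, Real.tsum_le_of_sum_le hn hs⟩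
  have hlow : ∀ᶠ lam in nhdsWithin (1 : ℝ) (Set.Iio 1), min c1 c2 / 2 ≤
      ∑' y : ℕ × ℕ, min (Ldist lam h1 y) (Ldist lam h2 y) := by
    have hε : (0 : ℝ) < 1 / ((N1 : ℝ) + N2 + 4) := by positivity
    filter_upwards [hnear _ hε] with lam hl
    obtain ⟨hl1, hl2⟩ := hl
    set x := 1 - lam with hx
    have hx0 : 0 < x := by linarith
    have hx1 : x < 1 / ((N1 : ℝ) + N2 + 4) := by linarith
    rw [lt_div_iff₀ (by positivity)] at hx1
    have n1 : (0 : ℝ) ≤ N1 := by positivity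
    have n2 : (0 : ℝ) ≤ N2 := by positivity
    have hxh : x ≤ 1 / 2 := by nlinarith
    set N := ⌈1 / x⌉₊ with hN
    have hNge : 1 / x ≤ N := Nat.le_ceil _
    have hNlt : (N : ℝ) < 1 / x + 1 := Nat.ceil_lt_add_one (by positivity)
    have hNx : 1 ≤ N * x := by rwa [div_le_iff₀ hx0] at hNge
    have hNx2 : N * x ≤ 2 := by
      have : (N : ℝ) * x ≤ (1 / x + 1) * x := by gcongr
      have e : (1 / x + 1) * x = 1 + x := by field_simp
      linarith
    have hbig : (N1 : ℝ) + N2 + 4 ≤ N := by nlinarith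
    have hbig' : N1 + N2 + 4 ≤ N := by exact_mod_cast hbig
    have hNpos : (0 : ℝ) < N := by linarith
    have hs2 : 2 ≤ √(N : ℝ) := Real.le_sqrt_of_sq_le (by linarith)
    have hr2 : √N ≤ (Nat.sqrt N : ℝ) + 1 := Real.real_sqrt_le_nat_sqrt_succ
    obtain ⟨hsm, -⟩ := hsummable lam (by linarith) hl2
    have hsum := hsm.sum_le_tsum
      ((Finset.range N ×ˢ Finset.range (Nat.sqrt N)).image (fun z : ℕ × ℕ => (N + z.1, N + z.1 + z.2)))
      (fun y _ => le_min (Ldist_nonneg (by linarith) hl2 hh1 y) (Ldist_nonneg (by linarith) hl2 hh2 y))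
    rw [Finset.sum_image (by
      rintro ⟨x1, x2⟩ _ ⟨y1, y2⟩ _ hxy
      simp only [Prod.mk.injEq] at hxy ⊢
      omega)] at hsum
    refine le_trans ?_ hsum
    have hterm : ∀ z ∈ Finset.range N ×ˢ Finset.range (Nat.sqrt N), min c1 c2 / (N * √N) ≤
        min (Ldist lam h1 (N + z.1, N + z.1 + z.2)) (Ldist lam h2 (N + z.1, N + z.1 + z.2)) := by
      intro z hz
      rw [Finset.mem_product, Finset.mem_range, Finset.mem_range] at hz
      have a1 := H1 N (by omega) lam (by linarith) hl2 hNx hNx2 z.1 z.2 hz.1 hz.2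
      have a2 := H2 N (by omega) lam (by linarith) hl2 hNx hNx2 z.1 z.2 hz.1 hz.2
      refine le_min (le_trans ?_ a1) (le_trans ?_ a2)
      · have := min_le_left c1 c2
        gcongr
      · have := min_le_right c1 c2
        gcongr
    refine le_trans ?_ (Finset.card_nsmul_le_sum _ _ _ hterm)
    rw [Finset.card_product, Finset.card_range, Finset.card_range, nsmul_eq_mul, Nat.cast_mul]
    have hm : 0 < min c1 c2 := lt_min hc1 hc2
    calc min c1 c2 / 2 = N * (√N / 2) * (min c1 c2 / (N * √N)) := by
          have : 0 < √(N : ℝ) := by linarith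
          field_simp
      _ ≤ _ := by
          have : √(N : ℝ) / 2 ≤ Nat.sqrt N := by linarith
          gcongr
  refine lt_of_lt_of_le (half_pos (lt_min hc1 hc2)) (le_liminf_of_le ?_ hlow)
  refine IsBoundedUnder.isCoboundedUnder_ge ⟨1, ?_⟩
  rw [eventually_map]
  filter_upwards [hnear 1 one_pos] with lam hl
  exact (hsummable lam (by linarith [hl.1]) hl.2).2
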